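/- Suppose R is F-pure and let 𝔞 be an ideal of R. Let R̂ be the 𝔪-adic completion of R and let Ê be the injective envelope over R̂ of its residue field. Then 𝔞R̂ is a fully Φ_{R̂}(Ê)-special ideal of R̂ if and only if 𝔞 is a fully Φ(E)-special ideal of R. -/

import Mathlib

open TensorProduct IsLocalRing DirectSum

universe u v

/-! ### Frobenius twists and base change -/

/-- `R` viewed as an algebra over itself via the `n`-th power of the Frobenius
endomorphism; this plays the role of `R^{(n)}` (an `R`-module via `r • s = r ^ p ^ n * s`). -/
def FrobAlg (R : Type u) (p n : ℕ) [CommRing R] [Fact p.Prime] [CharP R p] : Type u := R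

namespace FrobAlg

variable (R : Type u) (p n : ℕ) [CommRing R] [Fact p.Prime] [CharP R p]

instance : CommRing (FrobAlg R p n) := inferInstanceAs (CommRing R)

instance : Algebra R (FrobAlg R p n) :=
  RingHom.toAlgebra (show R →+* FrobAlg R p n from (frobenius R p) ^ n)

/-- The canonical identification of `R` with the underlying set of `R^{(n)}`. -/
def of (r : R) : FrobAlg R p n := r

end FrobAlg

/-- The Frobenius base change `R^{(n)} ⊗_R M` of an `R`-module `M` along the `n`-th
power of the Frobenius endomorphism of `R`. -/
def FrobBC (R : Type u) (p n : ℕ) [CommRing R] [Fact p.Prime] [CharP R p]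
    (M : Type v) [AddCommGroup M] [Module R M] : Type (max u v) :=
  FrobAlg R p n ⊗[R] M

namespace FrobBC

variable (R : Type u) (p n : ℕ) [CommRing R] [Fact p.Prime] [CharP R p]
  (M : Type v) [AddCommGroup M] [Module R M]

noncomputable instance : AddCommGroup (FrobBC R p n M) :=
  inferInstanceAs (AddCommGroup (FrobAlg R p n ⊗[R] M))

/-- The `R`-module structure on `R^{(n)} ⊗_R M` given by multiplication on the first
factor. -/
noncomputable instance : Module R (FrobBC R p n M) :=
  inferInstanceAs (Module (FrobAlg R p n) (FrobAlg R p n ⊗[R] M))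

variable {M}

/-- The elementary tensor `r ⊗ m` in `R^{(n)} ⊗_R M`. -/
noncomputable def tmul (r : R) (m : M) : FrobBC R p n M := FrobAlg.of R p n r ⊗ₜ[R] m

end FrobBC

/-- `R` is `F`-pure if for every `R`-module `M` the natural map
`M → R^{(1)} ⊗_R M`, `m ↦ 1 ⊗ m`, is injective. -/
def IsFPure (R : Type u) (p : ℕ) [CommRing R] [Fact p.Prime] [CharP R p] : Prop :=
  ∀ (M : Type u) [AddCommGroup M] [Module R M],
    Function.Injective fun m : M => FrobBC.tmul R p 1 (1 : R) m

/-- An ideal `𝔞` of `R` is fully `Φ(E)`-special if for every `n ≥ 1`, every `r ∈ 𝔞` and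
every `e ∈ (0 :_E 𝔞)`, the element `r ⊗ e` is zero in `R^{(n)} ⊗_R E`. -/
def IsFullyPhiSpecial (R : Type u) (p : ℕ) [CommRing R] [Fact p.Prime] [CharP R p]
    (E : Type v) [AddCommGroup E] [Module R E] (𝔞 : Ideal R) : Prop :=
  ∀ n : ℕ, 1 ≤ n → ∀ r ∈ 𝔞, ∀ e : E, (∀ a ∈ 𝔞, a • e = 0) → FrobBC.tmul R p n r e = 0

/-! ### The module `Φ(E)` and the Frobenius shift -/

/-- The Frobenius `a ↦ a ^ p`, as an `R`-algebra map `R^{(n)} → R^{(n+1)}`. -/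
def frobStepAlg (R : Type u) (p n : ℕ) [CommRing R] [Fact p.Prime] [CharP R p] :
    FrobAlg R p n →ₐ[R] FrobAlg R p (n + 1) :=
  { (show FrobAlg R p n →+* FrobAlg R p (n + 1) from frobenius R p) with
    commutes' := fun r => by
      show frobenius R p (((frobenius R p) ^ n) r) = ((frobenius R p) ^ (n + 1)) r
      rw [pow_succ']
      rfl }

/-- The Frobenius `a ↦ a ^ p`, as an `R`-linear map `R^{(n)} → R^{(n+1)}`. -/
def frobStep (R : Type u) (p n : ℕ) [CommRing R] [Fact p.Prime] [CharP R p] :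
    FrobAlg R p n →ₗ[R] FrobAlg R p (n + 1) :=
  (frobStepAlg R p n).toLinearMap

/-- The graded module `Φ(E) = ⊕_{n ≥ 0} R^{(n)} ⊗_R E`. -/
def PhiModule (R : Type u) (p : ℕ) [CommRing R] [Fact p.Prime] [CharP R p]
    (E : Type v) [AddCommGroup E] [Module R E] : Type (max u v) :=
  ⨁ n : ℕ, FrobBC R p n E

namespace PhiModule

variable (R : Type u) (p : ℕ) [CommRing R] [Fact p.Prime] [CharP R p]
  (E : Type v) [AddCommGroup E] [Module R E]

noncomputable instance : AddCommGroup (PhiModule R p E) :=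
  inferInstanceAs (AddCommGroup (⨁ n : ℕ, FrobBC R p n E))

noncomputable instance : Module R (PhiModule R p E) :=
  inferInstanceAs (Module R (⨁ n : ℕ, FrobBC R p n E))

/-- The inclusion of the `n`-th component into `Φ(E)`. -/
noncomputable def of (n : ℕ) (g : FrobBC R p n E) : PhiModule R p E :=
  DirectSum.of (fun m : ℕ => FrobBC R p m E) n g

/-- The Frobenius-semilinear shift operator `x` on `Φ(E)`, sending an element
`r ⊗ e` of the `n`-th component to `r ^ p ⊗ e` in the `(n+1)`-th component. -/
noncomputable def shift : PhiModule R p E →+ PhiModule R p E :=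
  DirectSum.toAddMonoid fun n =>
    (DirectSum.of (fun m : ℕ => FrobBC R p m E) (n + 1)).comp
      (TensorProduct.map (frobStep R p n) (LinearMap.id (R := R) (M := E))).toAddMonoidHom

end PhiModule

/-- An ideal `𝔞` of `R` is `Φ(E)`-special if it is the annihilator of an
`R[x,f]`-submodule of `Φ(E)`, i.e. of an `R`-submodule stable under the shift operator. -/
def IsPhiSpecial (R : Type u) (p : ℕ) [CommRing R] [Fact p.Prime] [CharP R p]
    (E : Type v) [AddCommGroup E] [Module R E] (𝔞 : Ideal R) : Prop :=
  ∃ N : Submodule R (PhiModule R p E),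
    (∀ g ∈ N, PhiModule.shift R p E g ∈ N) ∧ 𝔞 = N.annihilator

/-! ### Further notions -/

/-- The `q`-th bracket (Frobenius) power `I^{[q]}` of an ideal: the ideal generated by
the `q`-th powers of the elements of `I`. -/
def Ideal.bracketPow {S : Type u} [CommRing S] (I : Ideal S) (q : ℕ) : Ideal S :=
  Ideal.span ((fun x => x ^ q) '' (I : Set S))

/-- A Noetherian local ring is regular if its maximal ideal can be generated by
`dim S` elements. -/
def IsRegularLocal (S : Type u) [CommRing S] [IsLocalRing S] : Prop :=
  ∃ s : Finset S, (s.card : WithBot (WithTop ℕ)) = ringKrullDim S ∧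
    Ideal.span (s : Set S) = maximalIdeal S

/-- An ideal `𝔟` of `R` is uniformly `F`-compatible if for every `n ≥ 1` and every
`R`-linear map `φ : R^{(n)} → R` one has `φ(𝔟) ⊆ 𝔟`. -/
def UniformlyFCompatible (R : Type u) (p : ℕ) [CommRing R] [Fact p.Prime] [CharP R p]
    (𝔟 : Ideal R) : Prop :=
  ∀ n : ℕ, 1 ≤ n → ∀ φ : FrobAlg R p n →ₗ[R] R, ∀ b ∈ 𝔟, φ (FrobAlg.of R p n b) ∈ 𝔟

/-- `R` is `F`-finite if `R^{(1)}` is a finitely generated `R`-module. -/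
def IsFFinite (R : Type u) (p : ℕ) [CommRing R] [Fact p.Prime] [CharP R p] : Prop :=
  Module.Finite R (FrobAlg R p 1)

/-- A Noetherian local ring `T` of characteristic `p` is strongly `F`-regular in the
sense of Lyubeznik and Smith if the tight closure of `0` in the injective envelope of
the residue field of `T` is zero. -/
def IsStronglyFRegularLS (T : Type u) (p : ℕ) [CommRing T] [IsLocalRing T]
    [Fact p.Prime] [CharP T p] : Prop :=
  ∀ (ET : Type u) [AddCommGroup ET] [Module T ET],
    Module.Injective T ET →
    ∀ ι : (T ⧸ maximalIdeal T) →ₗ[T] ET, Function.Injective ι →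
    (∀ N : Submodule T ET, N ⊓ LinearMap.range ι = ⊥ → N = ⊥) →
    ∀ m : ET,
      (∃ c : T, (∀ P ∈ minimalPrimes T, c ∉ P) ∧
        ∃ N₀ : ℕ, ∀ n : ℕ, N₀ ≤ n → FrobBC.tmul T p n c m = 0) → m = 0

/-- `Q` is a minimal primary decomposition of the ideal `𝔄`: the `Q i` are primary,
`𝔄` is their intersection, their radicals are pairwise distinct, and none of them
contains the intersection of the others. -/
def IsMinimalPrimaryDecomposition {S : Type u} [CommRing S] (𝔄 : Ideal S) {t : ℕ}
    (Q : Fin t → Ideal S) : Prop :=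
  𝔄 = ⨅ i, Q i ∧ (∀ i, (Q i).IsPrimary) ∧
    (Function.Injective fun i => (Q i).radical) ∧
    ∀ i, ¬ (⨅ j, ⨅ (_ : j ≠ i), Q j) ≤ Q i

namespace FrobBC

variable {R : Type u} {p n : ℕ} [CommRing R] [Fact p.Prime] [CharP R p]
  {M : Type v} [AddCommGroup M] [Module R M]

theorem _root_.FrobAlg.smul_of (s r : R) :
    s • FrobAlg.of R p n r = FrobAlg.of R p n (s ^ p ^ n * r) := by
  have h : ((frobenius R p) ^ n) s = s ^ p ^ n := by
    rw [RingHom.coe_pow, iterate_frobenius]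
  rw [Algebra.smul_def]
  exact congrArg (fun t : R => FrobAlg.of R p n (t * r)) h

theorem add_tmul (r s : R) (m : M) : tmul R p n (r + s) m = tmul R p n r m + tmul R p n s m :=
  TensorProduct.add_tmul (R := R) (FrobAlg.of R p n r) (FrobAlg.of R p n s) m

theorem tmul_add (r : R) (m m' : M) : tmul R p n r (m + m') = tmul R p n r m + tmul R p n r m' :=
  TensorProduct.tmul_add (R := R) (FrobAlg.of R p n r) m m'

theorem tmul_zero (r : R) : tmul R p n r (0 : M) = 0 :=
  TensorProduct.tmul_zero (R := R) M (FrobAlg.of R p n r)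

theorem smul_tmul (s r : R) (m : M) : s • tmul R p n r m = tmul R p n (s * r) m :=
  rfl

theorem tmul_smul (r s : R) (m : M) : tmul R p n r (s • m) = tmul R p n (s ^ p ^ n * r) m := by
  refine (TensorProduct.smul_tmul s (FrobAlg.of R p n r) m).symm.trans ?_
  rw [FrobAlg.smul_of]
  rfl

theorem induction_on {P : FrobBC R p n M → Prop} (x : FrobBC R p n M) (zero : P 0)
    (tmul : ∀ r m, P (tmul R p n r m)) (add : ∀ x y, P x → P y → P (x + y)) : P x :=
  TensorProduct.induction_on (R := R) (M := FrobAlg R p n) (N := M) (motive := P) x zero tmul add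

/-- Additive maps out of `R^{(n)} ⊗_R M` are balanced biadditive maps. -/
theorem exists_lift {A : Type*} [AddCommGroup A] (f : R →+ M →+ A)
    (hf : ∀ (s r : R) (m : M), f (s ^ p ^ n * r) m = f r (s • m)) :
    ∃ g : FrobBC R p n M →+ A, ∀ r m, g (tmul R p n r m) = f r m := by
  refine ⟨TensorProduct.liftAddHom (R := R) (M := FrobAlg R p n) (N := M) f fun s r m => ?_,
    fun r m => rfl⟩
  exact (congrArg (fun t : R => f t m) (FrobAlg.smul_of s r)).trans (hf s r m)

end FrobBC

section Torsion

variable {R : Type*} [CommRing R]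

theorem exists_pow_smul_eq_zero {M : Type*} [AddCommGroup M] [Module R M] {I : Ideal R}
    (hI : I.FG) (m : M) (h : ∀ x ∈ I, ∃ k : ℕ, x ^ k • m = 0) :
    ∃ k : ℕ, ∀ a ∈ I ^ k, a • m = 0 := by
  have hrad : I ≤ Ideal.radical (LinearMap.ker (LinearMap.toSpanSingleton R M m)) := fun x hx => by
    obtain ⟨k, hk⟩ := h x hx
    exact ⟨k, by simpa using hk⟩
  obtain ⟨k, hk⟩ := Ideal.exists_pow_le_of_le_radical_of_fg hrad hI
  exact ⟨k, fun a ha => by simpa using hk ha⟩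

/-- Over a Noetherian ring, an essential extension of `R/𝔪` consists of elements
annihilated by powers of `𝔪`. -/
theorem exists_maximalIdeal_pow_smul_eq_zero_of_essential [IsNoetherianRing R] [IsLocalRing R]
    {E : Type*} [AddCommGroup E] [Module R E] (ι : (R ⧸ maximalIdeal R) →ₗ[R] E)
    (hess : ∀ N : Submodule R E, N ⊓ LinearMap.range ι = ⊥ → N = ⊥) (e : E) :
    ∃ k : ℕ, ∀ a ∈ maximalIdeal R ^ k, a • e = 0 := by
  refine exists_pow_smul_eq_zero (IsNoetherian.noetherian _) e fun x hx => ?_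
  let f : ℕ →o Ideal R :=
    { toFun := fun n => LinearMap.ker (LinearMap.toSpanSingleton R E (x ^ n • e))
      monotone' := monotone_nat_of_le_succ fun n r hr => by
        simp only [LinearMap.mem_ker, LinearMap.toSpanSingleton_apply] at hr ⊢
        rw [pow_succ', mul_smul, smul_comm, hr, smul_zero] }
  obtain ⟨n, hn⟩ := monotone_stabilizes_iff_noetherian.mpr ‹IsNoetherian R R› f
  refine ⟨n, ?_⟩
  have hbot : Submodule.span R {x ^ n • e} = ⊥ := by
    apply hess
    rw [eq_bot_iff]
    rintro _ ⟨hy, u, rfl⟩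
    obtain ⟨r, hr⟩ := Submodule.mem_span_singleton.mp hy
    have hxu : x • u = 0 := by
      obtain ⟨s, rfl⟩ := Ideal.Quotient.mk_surjective u
      change Ideal.Quotient.mk _ (x * s) = 0
      exact Ideal.Quotient.eq_zero_iff_mem.mpr (Ideal.mul_mem_right _ _ hx)
    have hmem : r ∈ f (n + 1) := by
      change r • x ^ (n + 1) • e = 0
      rw [pow_succ', mul_smul, smul_comm, hr, ← map_smul, hxu, map_zero]
    rw [← hn (n + 1) n.le_succ] at hmem
    exact hr.symm.trans hmem
  exact Submodule.span_singleton_eq_bot.mp hbot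

theorem FrobBC.exists_ideal_pow_smul_eq_zero {R : Type u} {p : ℕ} [CommRing R] [Fact p.Prime]
    [CharP R p] {M : Type v} [AddCommGroup M] [Module R M] {I : Ideal R} (hI : I.FG)
    (htor : ∀ m : M, ∃ k : ℕ, ∀ a ∈ I ^ k, a • m = 0) (n : ℕ) (y : FrobBC R p n M) :
    ∃ k : ℕ, ∀ a ∈ I ^ k, a • y = 0 := by
  refine exists_pow_smul_eq_zero hI y fun x hx => ?_
  induction y using FrobBC.induction_on with
  | zero => exact ⟨0, smul_zero _⟩
  | tmul r m =>
    obtain ⟨k, hk⟩ := htor m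
    refine ⟨k * p ^ n, ?_⟩
    rw [FrobBC.smul_tmul, pow_mul, ← FrobBC.tmul_smul, hk _ (Ideal.pow_mem_pow hx k),
      FrobBC.tmul_zero]
  | add y z hy hz =>
    obtain ⟨k, hk⟩ := hy
    obtain ⟨l, hl⟩ := hz
    refine ⟨k + l, ?_⟩
    rw [smul_add, pow_add, mul_smul, mul_smul, hl, smul_zero, add_zero, smul_comm, hk, smul_zero]

end Torsion

section Completion

variable {R R' : Type*} [CommRing R] [CommRing R'] [Algebra R R'] {I : Ideal R}
  {M : Type*} [AddCommGroup M] [Module R M]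

theorem smul_eq_smul_of_sub_mem_map [Module R' M] [IsScalarTower R R' M] {J : Ideal R} {m : M}
    (hm : ∀ a ∈ J, a • m = 0) {r' : R'} {r : R}
    (h : r' - algebraMap R R' r ∈ J.map (algebraMap R R')) : r' • m = r • m := by
  have hle : J.map (algebraMap R R') ≤ LinearMap.ker (LinearMap.toSpanSingleton R' M m) :=
    Ideal.map_le_iff_le_comap.mpr fun a ha => by
      simpa [Ideal.mem_comap] using hm a ha
  have := hle h
  rw [LinearMap.mem_ker, LinearMap.toSpanSingleton_apply, sub_smul, algebraMap_smul] at this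
  exact sub_eq_zero.mp this

/-- If `R → R'` induces isomorphisms modulo all powers of `I`, every `I`-power torsion
`R`-module carries a compatible `R'`-module structure. -/
theorem exists_module_of_torsion
    (hinj : ∀ (k : ℕ) (r : R), algebraMap R R' r ∈ (I ^ k).map (algebraMap R R') → r ∈ I ^ k)
    (hsurj : ∀ (k : ℕ) (r' : R'), ∃ r : R, r' - algebraMap R R' r ∈ (I ^ k).map (algebraMap R R'))
    (htor : ∀ m : M, ∃ k : ℕ, ∀ a ∈ I ^ k, a • m = 0) :
    ∃ _ : Module R' M, IsScalarTower R R' M := by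
  choose κ hκ using htor
  choose ρ hρ using hsurj
  have key : ∀ (k : ℕ) (r' : R') (m : M) (r : R), (∀ a ∈ I ^ k, a • m = 0) →
      r' - algebraMap R R' r ∈ (I ^ k).map (algebraMap R R') → ρ (κ m) r' • m = r • m := by
    have close : ∀ (k l : ℕ) (r' : R') (m : M) (r : R), k ≤ l → (∀ a ∈ I ^ k, a • m = 0) →
        r' - algebraMap R R' r ∈ (I ^ k).map (algebraMap R R') → ρ l r' • m = r • m := by
      intro k l r' m r hkl hm h
      have h' := Ideal.sub_mem _ h (Ideal.map_mono (Ideal.pow_le_pow_right hkl) (hρ l r'))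
      rw [sub_sub_sub_cancel_left, ← map_sub] at h'
      have := hm _ (hinj _ _ h')
      rwa [sub_smul, sub_eq_zero] at this
    intro k r' m r hm h
    rw [← close k (max k (κ m)) r' m r (le_max_left _ _) hm h,
      close (κ m) (max k (κ m)) r' m _ (le_max_right _ _) (hκ m) (hρ _ _)]
  have hle : ∀ (k l : ℕ) (m : M), k ≤ l → (∀ a ∈ I ^ k, a • m = 0) → ∀ a ∈ I ^ l, a • m = 0 :=
    fun k l m hkl h a ha => h a (Ideal.pow_le_pow_right hkl ha)
  have halg : ∀ (r : R) (m : M), ρ (κ m) (algebraMap R R' r) • m = r • m := fun r m =>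
    key (κ m) _ m r (hκ m) (by simp)
  let inst : Module R' M :=
    { smul := fun r' m => ρ (κ m) r' • m
      one_smul := fun m => by
        have := halg 1 m
        rw [map_one, one_smul] at this
        exact this
      mul_smul := fun r' s' m => by
        change ρ (κ m) (r' * s') • m = ρ (κ (ρ (κ m) s' • m)) r' • ρ (κ m) s' • m
        rw [key (κ m) r' (ρ (κ m) s' • m) (ρ (κ m) r')
          (fun a ha => by rw [smul_comm, hκ m a ha, smul_zero]) (hρ _ _), ← mul_smul]
        refine key (κ m) _ m _ (hκ m) ?_
        rw [map_mul, show r' * s' - algebraMap R R' (ρ (κ m) r') * algebraMap R R' (ρ (κ m) s') =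
          r' * (s' - algebraMap R R' (ρ (κ m) s')) +
          algebraMap R R' (ρ (κ m) s') * (r' - algebraMap R R' (ρ (κ m) r')) by ring]
        exact Ideal.add_mem _ (Ideal.mul_mem_left _ _ (hρ _ _)) (Ideal.mul_mem_left _ _ (hρ _ _))
      smul_zero := fun r' => smul_zero _
      smul_add := fun r' m m' => by
        change ρ (κ (m + m')) r' • (m + m') = ρ (κ m) r' • m + ρ (κ m') r' • m'
        have h1 := hle _ (max (κ m) (κ m')) m (le_max_left _ _) (hκ m)
        have h2 := hle _ (max (κ m) (κ m')) m' (le_max_right _ _) (hκ m')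
        rw [key _ r' m _ h1 (hρ _ _), key _ r' m' _ h2 (hρ _ _), ← smul_add]
        exact key _ r' _ _ (fun a ha => by rw [smul_add, h1 a ha, h2 a ha, add_zero]) (hρ _ _)
      add_smul := fun r' s' m => by
        change ρ (κ m) (r' + s') • m = ρ (κ m) r' • m + ρ (κ m) s' • m
        rw [← add_smul]
        refine key (κ m) _ m _ (hκ m) ?_
        rw [map_add, add_sub_add_comm]
        exact Ideal.add_mem _ (hρ _ _) (hρ _ _)
      zero_smul := fun m => by
        have := halg 0 m
        rw [map_zero, zero_smul] at this
        exact this }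
  exact ⟨inst, IsScalarTower.of_algebraMap_smul halg⟩

/-- An `R`-linear map out of an `I`-power torsion module is linear over the completion. -/
theorem map_smul_of_torsion {N : Type*} [AddCommGroup N] [Module R N]
    [Module R' M] [IsScalarTower R R' M] [Module R' N] [IsScalarTower R R' N]
    (hsurj : ∀ (k : ℕ) (r' : R'), ∃ r : R, r' - algebraMap R R' r ∈ (I ^ k).map (algebraMap R R'))
    (htor : ∀ m : M, ∃ k : ℕ, ∀ a ∈ I ^ k, a • m = 0) (f : M →ₗ[R] N) (r' : R') (m : M) :
    f (r' • m) = r' • f m := by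
  obtain ⟨k, hk⟩ := htor m
  obtain ⟨r, hr⟩ := hsurj k r'
  rw [smul_eq_smul_of_sub_mem_map hk hr, map_smul, smul_eq_smul_of_sub_mem_map _ hr]
  intro a ha
  rw [← map_smul, hk a ha, map_zero]

end Completion

/-- The injective hulls of the residue fields of `R` and of its completion `R'` are
isomorphic as `R`-modules. -/
theorem nonempty_injectiveHull_equiv_completion {R R' E E' : Type u} [CommRing R]
    [IsNoetherianRing R] [IsLocalRing R] [CommRing R'] [IsLocalRing R'] [Algebra R R']
    [AddCommGroup E] [Module R E] [AddCommGroup E'] [Module R' E'] [Module R E']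
    [IsScalarTower R R' E']
    (hmax : maximalIdeal R' = (maximalIdeal R).map (algebraMap R R'))
    (hinj : ∀ (k : ℕ) (r : R),
      algebraMap R R' r ∈ (maximalIdeal R ^ k).map (algebraMap R R') → r ∈ maximalIdeal R ^ k)
    (hsurj : ∀ (k : ℕ) (r' : R'),
      ∃ r : R, r' - algebraMap R R' r ∈ (maximalIdeal R ^ k).map (algebraMap R R'))
    (hE : Module.Injective R E)
    (ι : (R ⧸ maximalIdeal R) →ₗ[R] E) (hι : Function.Injective ι)
    (hess : ∀ N : Submodule R E, N ⊓ LinearMap.range ι = ⊥ → N = ⊥)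
    (hE' : Module.Injective R' E')
    (ι' : (R' ⧸ maximalIdeal R') →ₗ[R'] E') (hι' : Function.Injective ι')
    (hess' : ∀ N : Submodule R' E', N ⊓ LinearMap.range ι' = ⊥ → N = ⊥)
    (htor' : ∀ e : E', ∃ k : ℕ, ∀ a ∈ maximalIdeal R ^ k, a • e = 0) :
    Nonempty (E' ≃ₗ[R] E) := by
  have htor := exists_maximalIdeal_pow_smul_eq_zero_of_essential ι hess
  obtain ⟨_, _⟩ := exists_module_of_torsion hinj hsurj htor
  have hmk : ∀ r : R, ι (Ideal.Quotient.mk _ r) = r • ι 1 := fun r => by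
    rw [← map_smul]; congr 1; exact (mul_one (Ideal.Quotient.mk _ r)).symm
  have hmk' : ∀ r : R', ι' (Ideal.Quotient.mk _ r) = r • ι' 1 := fun r => by
    rw [← map_smul]; congr 1; exact (mul_one (Ideal.Quotient.mk _ r)).symm
  have hne : ι 1 ≠ 0 := fun h => one_ne_zero (hι (h.trans (map_zero ι).symm))
  let s := LinearMap.toSpanSingleton R' E (ι 1)
  have hker : maximalIdeal R' = LinearMap.ker s := by
    refine (maximalIdeal.isMaximal R').eq_of_le (fun h => hne ?_) ?_
    · have : (1 : R') ∈ LinearMap.ker s := h ▸ Submodule.mem_top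
      simpa [s] using this
    · rw [hmax]
      refine Ideal.map_le_iff_le_comap.mpr fun a ha => ?_
      have : a • ι 1 = 0 := by
        rw [← hmk, Ideal.Quotient.eq_zero_iff_mem.mpr ha, map_zero]
      simpa [s, Ideal.mem_comap] using this
  let f : (R' ⧸ maximalIdeal R') →ₗ[R'] E := Submodule.liftQ _ s hker.le
  have hf : Function.Injective f := by
    rw [← LinearMap.ker_eq_bot]
    exact Submodule.ker_liftQ_eq_bot _ _ _ hker.ge
  obtain ⟨h, hh⟩ := hE'.out f hf ι'
  have hone : h (ι 1) = ι' 1 := by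
    rw [← hh]
    congr 1
    exact (one_smul R' (ι 1)).symm
  have hhinj : Function.Injective (h.restrictScalars R) := by
    rw [← LinearMap.ker_eq_bot]
    apply hess
    rw [eq_bot_iff]
    rintro _ ⟨hy, u, rfl⟩
    obtain ⟨r, rfl⟩ := Ideal.Quotient.mk_surjective u
    have h0 : h (ι (Ideal.Quotient.mk _ r)) = 0 := hy
    rw [hmk, ← algebraMap_smul R' r, map_smul, hone, ← hmk', ← map_zero ι'] at h0
    have hr := Ideal.Quotient.eq_zero_iff_mem.mp (hι' h0)
    have hr' : r ∈ maximalIdeal R := by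
      simpa using hinj 1 r (by rwa [pow_one, ← hmax])
    rw [Ideal.Quotient.eq_zero_iff_mem.mpr hr', map_zero]
    exact zero_mem _
  obtain ⟨g, hg⟩ := hE.out (h.restrictScalars R) hhinj LinearMap.id
  let g' : E' →ₗ[R'] E :=
    { toFun := g
      map_add' := g.map_add
      map_smul' := map_smul_of_torsion hsurj htor' g }
  refine ⟨LinearEquiv.ofBijective g ⟨?_, fun x => ⟨h x, hg x⟩⟩⟩
  have hbot : LinearMap.ker g' = ⊥ := by
    apply hess'
    rw [eq_bot_iff]
    rintro _ ⟨hy, u, rfl⟩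
    obtain ⟨r, rfl⟩ := Ideal.Quotient.mk_surjective u
    have h0 : g (ι' (Ideal.Quotient.mk _ r)) = 0 := hy
    rw [hmk', ← hone, ← map_smul] at h0 ⊢
    have h1 : r • ι 1 = 0 := (hg _).symm.trans h0
    rw [h1, map_zero]
    exact zero_mem _
  exact (LinearMap.ker_eq_bot.mp hbot : Function.Injective g')

namespace FrobBC

variable {R R' : Type u} {p : ℕ} [CommRing R] [Fact p.Prime] [CharP R p] [CommRing R']
  [CharP R' p] [Algebra R R'] {E E' : Type v} [AddCommGroup E] [Module R E]
  [AddCommGroup E'] [Module R' E'] [Module R E'] [IsScalarTower R R' E']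

theorem exists_baseChange (φ : E →ₗ[R] E') (n : ℕ) :
    ∃ g : FrobBC R p n E →+ FrobBC R' p n E',
      ∀ r e, g (tmul R p n r e) = tmul R' p n (algebraMap R R' r) (φ e) := by
  refine exists_lift (AddMonoidHom.mk' (fun r => AddMonoidHom.mk'
    (fun e => tmul R' p n (algebraMap R R' r) (φ e)) fun e e' => ?_) fun r s => ?_) fun s r e => ?_
  · rw [map_add, tmul_add]
  · ext e
    simp [add_tmul]
  · change tmul R' p n (algebraMap R R' (s ^ p ^ n * r)) (φ e) =
      tmul R' p n (algebraMap R R' r) (φ (s • e))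
    rw [map_smul, ← algebraMap_smul R' s, tmul_smul, map_mul, map_pow]

theorem exists_retraction {I : Ideal R} (hI : I.FG)
    (hinj : ∀ (k : ℕ) (r : R), algebraMap R R' r ∈ (I ^ k).map (algebraMap R R') → r ∈ I ^ k)
    (hsurj : ∀ (k : ℕ) (r' : R'), ∃ r : R, r' - algebraMap R R' r ∈ (I ^ k).map (algebraMap R R'))
    (htor : ∀ e : E, ∃ k : ℕ, ∀ a ∈ I ^ k, a • e = 0)
    (ψ : E' ≃ₗ[R] E) (n : ℕ) :
    ∃ g : FrobBC R' p n E' →+ FrobBC R p n E,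
      ∀ r e, g (tmul R' p n (algebraMap R R' r) (ψ.symm e)) = tmul R p n r e := by
  have htorN := exists_ideal_pow_smul_eq_zero (p := p) hI htor n
  obtain ⟨_, _⟩ := exists_module_of_torsion hinj hsurj htorN
  have hle : ∀ (k l : ℕ), k ≤ l → I ^ l ≤ I ^ k := fun _ _ => Ideal.pow_le_pow_right
  obtain ⟨g, hg⟩ := exists_lift (R := R') (p := p) (n := n) (M := E') (AddMonoidHom.mk'
    (fun r' : R' => AddMonoidHom.mk' (fun e : E' => r' • tmul R p n 1 (ψ e))
      fun e e' => by rw [map_add, tmul_add, smul_add])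
    fun r s => by ext e; exact add_smul r s _) fun s' r' e => by
      change (s' ^ p ^ n * r') • tmul R p n 1 (ψ e) = r' • tmul R p n 1 (ψ (s' • e))
      obtain ⟨k, hk⟩ := htor (ψ e)
      obtain ⟨l, hl⟩ := htorN (tmul R p n 1 (ψ e))
      obtain ⟨t, ht⟩ := hsurj (max k l) s'
      have hke : ∀ a ∈ I ^ max k l, a • e = 0 := fun a ha => by
        apply ψ.injective
        rw [map_smul, hk a (hle _ _ (le_max_left _ _) ha), map_zero]
      have htq : s' ^ p ^ n - algebraMap R R' (t ^ p ^ n) ∈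
          (I ^ max k l).map (algebraMap R R') := by
        rw [map_pow]
        exact Ideal.mem_of_dvd _ (sub_dvd_pow_sub_pow _ _ _) ht
      rw [smul_eq_smul_of_sub_mem_map hke ht, map_smul, tmul_smul, mul_comm, mul_smul,
        smul_eq_smul_of_sub_mem_map (fun a ha => hl a (hle _ _ (le_max_right _ _) ha)) htq,
        smul_tmul]
  refine ⟨g, fun r e => ?_⟩
  rw [hg]
  change algebraMap R R' r • tmul R p n 1 (ψ (ψ.symm e)) = _
  rw [ψ.apply_symm_apply, algebraMap_smul, smul_tmul, mul_one]

end FrobBC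

theorem fully_special_iff_fully_special_completion (R : Type u) [CommRing R] [IsNoetherianRing R] [IsLocalRing R]
    (p : ℕ) [Fact p.Prime] [CharP R p]
    (E : Type u) [AddCommGroup E] [Module R E]
    (hE : Module.Injective R E)
    (ι : (R ⧸ maximalIdeal R) →ₗ[R] E) (hι : Function.Injective ι)
    (hess : ∀ N : Submodule R E, N ⊓ LinearMap.range ι = ⊥ → N = ⊥)
    (hFpure : IsFPure R p)
    (R' : Type u) [CommRing R'] [IsNoetherianRing R'] [IsLocalRing R'] [CharP R' p]
    [Algebra R R']
    (hmax : maximalIdeal R' = (maximalIdeal R).map (algebraMap R R'))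
    (hcomplete : IsAdicComplete (maximalIdeal R') R')
    (hquot : ∀ n : ℕ, Function.Bijective
      (Ideal.quotientMap ((maximalIdeal R ^ n).map (algebraMap R R')) (algebraMap R R')
        Ideal.le_comap_map))
    (E' : Type u) [AddCommGroup E'] [Module R' E']
    (hE' : Module.Injective R' E')
    (ι' : (R' ⧸ maximalIdeal R') →ₗ[R'] E') (hι' : Function.Injective ι')
    (hess' : ∀ N : Submodule R' E', N ⊓ LinearMap.range ι' = ⊥ → N = ⊥)
    (𝔞 : Ideal R) :
    IsFullyPhiSpecial R' p E' (𝔞.map (algebraMap R R')) ↔ IsFullyPhiSpecial R p E 𝔞 := by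
  let _ : Module R E' := Module.compHom E' (algebraMap R R')
  have : IsScalarTower R R' E' := IsScalarTower.of_algebraMap_smul fun _ _ => rfl
  have hinj : ∀ (k : ℕ) (r : R),
      algebraMap R R' r ∈ (maximalIdeal R ^ k).map (algebraMap R R') → r ∈ maximalIdeal R ^ k := by
    intro k r hr
    refine Ideal.Quotient.eq_zero_iff_mem.mp ((hquot k).injective ?_)
    rw [Ideal.quotientMap_mk, map_zero]
    exact Ideal.Quotient.eq_zero_iff_mem.mpr hr
  have hsurj : ∀ (k : ℕ) (r' : R'),
      ∃ r : R, r' - algebraMap R R' r ∈ (maximalIdeal R ^ k).map (algebraMap R R') := by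
    intro k r'
    obtain ⟨x, hx⟩ := (hquot k).surjective (Ideal.Quotient.mk _ r')
    obtain ⟨r, rfl⟩ := Ideal.Quotient.mk_surjective x
    rw [Ideal.quotientMap_mk] at hx
    exact ⟨r, Ideal.Quotient.eq.mp hx.symm⟩
  have htor := exists_maximalIdeal_pow_smul_eq_zero_of_essential ι hess
  have htor' : ∀ e : E', ∃ k : ℕ, ∀ a ∈ maximalIdeal R ^ k, a • e = 0 := by
    intro e
    obtain ⟨k, hk⟩ := exists_maximalIdeal_pow_smul_eq_zero_of_essential ι' hess' e
    refine ⟨k, fun a ha => hk (algebraMap R R' a) ?_⟩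
    rw [hmax, ← Ideal.map_pow]
    exact Ideal.mem_map_of_mem _ ha
  obtain ⟨ψ⟩ := nonempty_injectiveHull_equiv_completion hmax hinj hsurj hE ι hι hess hE' ι' hι'
    hess' htor'
  constructor
  · intro h n hn r hr e he
    obtain ⟨g, hg⟩ := FrobBC.exists_retraction (p := p) (IsNoetherian.noetherian (maximalIdeal R))
      hinj hsurj htor ψ n
    rw [← hg, h n hn _ (Ideal.mem_map_of_mem _ hr), map_zero]
    have hle : 𝔞.map (algebraMap R R') ≤
        LinearMap.ker (LinearMap.toSpanSingleton R' E' (ψ.symm e)) :=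
      Ideal.map_le_iff_le_comap.mpr fun a ha => by
        simp [Ideal.mem_comap, ← map_smul, he a ha]
    exact fun a ha => hle ha
  · intro h n hn r hr e he
    obtain ⟨g, hg⟩ := FrobBC.exists_baseChange (p := p) (R' := R') ψ.symm.toLinearMap n
    refine Submodule.span_induction (p := fun r _ => FrobBC.tmul R' p n r e = 0) ?_ ?_ ?_ ?_ hr
    · rintro _ ⟨a, ha, rfl⟩
      have hz := h n hn a ha (ψ e) fun b hb => by
        rw [← map_smul, ← algebraMap_smul R' b, he _ (Ideal.mem_map_of_mem _ hb), map_zero]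
      have := hg a (ψ e)
      rw [hz, map_zero] at this
      simpa using this.symm
    · rw [← zero_smul R' (FrobBC.tmul R' p n (0 : R') e), FrobBC.smul_tmul, zero_mul]
    · intro x y _ _ hx hy
      rw [FrobBC.add_tmul, hx, hy, add_zero]
    · intro s x _ hx
      rw [smul_eq_mul, ← FrobBC.smul_tmul, hx, smul_zero]
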